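/- Invariant form of the Hugoniot relations, first identity: assume the Rankine–Hugoniot relation holds, W_I ≠ Z, the positivity conditions μ_I + p_I > 0, μ_II + p_II > 0, μ_I + p_II > 0, μ_II + p_I > 0, and μ_I − p_I ≠ μ_II − p_II. Then (η(u_I, u_II))² · (μ_I + p_I)(μ_II + p_II) = (μ_I + p_II)(μ_II + p_I). -/

import Mathlib

open Real

/-- Squared Euclidean norm of a vector. -/
noncomputable def nsq {n : ℕ} (w : Fin n → ℝ) : ℝ := ∑ j, (w j) ^ 2

/-- Minkowski bilinear form on `ℝ^{d+1}`: `η(x,y) = -x₀y₀ + ∑_{j=1}^d xⱼyⱼ`. -/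
noncomputable def eta {d : ℕ} (x y : Fin (d + 1) → ℝ) : ℝ :=
  -(x 0 * y 0) + ∑ j : Fin d, x j.succ * y j.succ

/-- Unit spacelike normal `V = (sinh Z, cosh Z, 0, …, 0)` to the interface. -/
noncomputable def normalV (d : ℕ) (Z : ℝ) : Fin (d + 1) → ℝ := fun i =>
  if i.val = 0 then Real.sinh Z else if i.val = 1 then Real.cosh Z else 0

/-- Unit timelike fluid velocity determined by the perpendicular rapidity `W` and
the parallel velocity `w ∈ ℝ^{d-1}`. -/
noncomputable def vel (d : ℕ) (W : ℝ) (w : Fin (d - 1) → ℝ) : Fin (d + 1) → ℝ := fun i =>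
  if i.val = 0 then Real.sqrt (1 + nsq w) * Real.cosh W
  else if i.val = 1 then Real.sqrt (1 + nsq w) * Real.sinh W
  else if h : i.val - 2 < d - 1 then w ⟨i.val - 2, h⟩ else 0

/-- The Rankine–Hugoniot relation
`(μ_II + p_II) η(u_II,V) u_II − (μ_I + p_I) η(u_I,V) u_I + (p_II − p_I) V = 0`. -/
def RH (d : ℕ) (μI pI μII pII : ℝ) (uI uII V : Fin (d + 1) → ℝ) : Prop :=
  ∀ i, (μII + pII) * eta uII V * uII i - (μI + pI) * eta uI V * uI i + (pII - pI) * V i = 0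

theorem eta_comm {d : ℕ} (x y : Fin (d + 1) → ℝ) : eta x y = eta y x := by
  simp only [eta, mul_comm]

theorem eta_vel_self (m : ℕ) (W : ℝ) (w : Fin (m + 1 - 1) → ℝ) :
    eta (vel (m + 1) W w) (vel (m + 1) W w) = -1 := by
  have hn : 0 ≤ nsq w := Finset.sum_nonneg fun j _ => sq_nonneg (w j)
  have hs := Real.sq_sqrt (show 0 ≤ 1 + nsq w by linarith)
  have hc := Real.cosh_sq W
  have hsum : ∑ j : Fin m, w j * w j = nsq w :=
    Finset.sum_congr rfl fun j _ => (sq (w j)).symm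
  rw [eta, Fin.sum_univ_succ]
  simp [vel]
  rw [hsum]
  linear_combination (-(1 + nsq w)) * hc + (Real.sinh W ^ 2 - Real.cosh W ^ 2) * hs

theorem eta_vel_normalV (m : ℕ) (W Z : ℝ) (w : Fin (m + 1 - 1) → ℝ) :
    eta (vel (m + 1) W w) (normalV (m + 1) Z) = Real.sqrt (1 + nsq w) * Real.sinh (W - Z) := by
  rw [eta, Fin.sum_univ_succ]
  simp [vel, normalV, Real.sinh_sub]
  ring

/-- The Rankine–Hugoniot relation contracted with an arbitrary vector. -/
theorem RH.eta_eq_zero {d : ℕ} {μI pI μII pII : ℝ} {uI uII V : Fin (d + 1) → ℝ}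
    (h : RH d μI pI μII pII uI uII V) (x : Fin (d + 1) → ℝ) :
    (μII + pII) * eta uII V * eta uII x - (μI + pI) * eta uI V * eta uI x
      + (pII - pI) * eta V x = 0 := by
  have hsum : ∑ j : Fin d, ((μII + pII) * eta uII V * uII j.succ
      - (μI + pI) * eta uI V * uI j.succ + (pII - pI) * V j.succ) * x j.succ = 0 :=
    Finset.sum_eq_zero fun j _ => by rw [h j.succ, zero_mul]
  simp only [add_mul, sub_mul _ _ (x _), Finset.sum_add_distrib, Finset.sum_sub_distrib, mul_assoc,
    ← Finset.mul_sum] at hsum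
  rw [eta.eq_def uII x, eta.eq_def uI x, eta.eq_def V x]
  linear_combination hsum - x 0 * h 0

/-- Invariant form of the Hugoniot relations, first identity. -/
theorem hugoniot_invariant_first (d : ℕ) (hd : 2 ≤ d) (Z μI μII pI pII WI WII : ℝ)
    (wI wII : Fin (d - 1) → ℝ) (hμI : 0 ≤ μI) (hμII : 0 ≤ μII)
    (hW : WI ≠ Z)
    (h1 : 0 < μI + pI) (h2 : 0 < μII + pII) (h3 : 0 < μI + pII) (h4 : 0 < μII + pI)
    (hne : μI - pI ≠ μII - pII)
    (hRH : RH d μI pI μII pII (vel d WI wI) (vel d WII wII) (normalV d Z)) :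
    (eta (vel d WI wI) (vel d WII wII)) ^ 2 * ((μI + pI) * (μII + pII))
      = (μI + pII) * (μII + pI) := by
  obtain ⟨m, rfl⟩ : ∃ m, d = m + 1 := ⟨d - 1, by omega⟩
  have ha : eta (vel (m + 1) WI wI) (normalV (m + 1) Z) ≠ 0 := by
    have hn : 0 ≤ nsq wI := Finset.sum_nonneg fun j _ => sq_nonneg (wI j)
    rw [eta_vel_normalV]
    exact mul_ne_zero (Real.sqrt_pos.2 (by linarith)).ne'
      (Real.sinh_ne_zero.2 (sub_ne_zero.2 hW))
  have eI := hRH.eta_eq_zero (vel (m + 1) WI wI)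
  have eII := hRH.eta_eq_zero (vel (m + 1) WII wII)
  rw [eta_vel_self, eta_comm (normalV _ _), eta_comm (vel _ WII _) (vel _ WI _)] at eI
  rw [eta_vel_self, eta_comm (normalV _ _)] at eII
  generalize eta (vel (m + 1) WI wI) (normalV (m + 1) Z) = a at *
  generalize eta (vel (m + 1) WII wII) (normalV (m + 1) Z) = b at *
  generalize eta (vel (m + 1) WI wI) (vel (m + 1) WII wII) = e at *
  have hb : b ≠ 0 := by
    rintro rfl
    exact mul_ne_zero h3.ne' ha (by linear_combination eI)
  apply mul_right_cancel₀ (mul_ne_zero ha hb)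
  linear_combination (μI + pI) * a * e * eI + (μI + pII) * a * eII
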